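/- arXiv:2003.14057 — 2 statements merged into one kernel-verified Lean document; each statement's English description precedes it below -/
import Mathlib

section
/- Let M = r^a with r prime, gcd(q, M) = 1, and α ∈ GL(n, F_q). Suppose that F_q^n, viewed as an F_q[X]-module with X acting as α, is isomorphic to ⊕_{i=1}^{l} ⊕_{j ≥ 1} (F_q[X]/(f_i^{j}))^{⊕ m_{ij}}, where f_1,…,f_l are distinct monic irreducible polynomials ≠ X and m_{ij} ≥ 0 are multiplicities (with, for each i, m_{ij} > 0 for some j). Then X^M = α has a solution in GL(n, F_q) if and only if for each i one of the following holds: (1) f_i is an M-power polynomial; or (2) f_i ∈ Φ_{M,b} for some 1 ≤ b ≤ a and r^b divides m_{ij} for every j. -/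
open Polynomial DirectSum

lemma not_X_dvd_of_irreducible {F : Type*} [Field F] {f : F[X]} (hfm : f.Monic)
    (hfi : Irreducible f) (hfX : f ≠ X) : ¬ X ∣ f := fun h =>
  hfX (eq_of_monic_of_associated monic_X hfm (irreducible_X.associated_of_dvd hfi h)).symm

/-- A nonzero element algebraic over a finite field has finite order, coprime to the
cardinality of the field. -/
lemma orderOf_pos_and_coprime_card {F L : Type*} [Field F] [Fintype F] [Field L] [Algebra F L]
    {x : L} (hx : IsIntegral F x) (hx0 : x ≠ 0) :
    0 < orderOf x ∧ (Fintype.card F).Coprime (orderOf x) := by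
  have := IntermediateField.adjoin.finiteDimensional hx
  have : Finite (IntermediateField.adjoin F {x}) := Module.finite_of_finite F
  have := Fintype.ofFinite (IntermediateField.adjoin F {x})
  set y := IntermediateField.AdjoinSimple.gen F x
  have hyx : algebraMap _ L y = x := IntermediateField.AdjoinSimple.algebraMap_gen F x
  have hy0 : y ≠ 0 := fun h => hx0 (by rw [← hyx, h, map_zero])
  have h1 := FiniteField.pow_card_sub_one_eq_one y hy0
  have h2 : x ^ (Fintype.card (IntermediateField.adjoin F {x}) - 1) = 1 := by
    have := congrArg (algebraMap _ L) h1
    rwa [map_pow, hyx, map_one] at this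
  have hd := orderOf_dvd_of_pow_eq_one h2
  have hc := Module.card_eq_pow_finrank (K := F) (V := IntermediateField.adjoin F {x})
  have hgt : 1 < Fintype.card (IntermediateField.adjoin F {x}) := Fintype.one_lt_card
  have hfr : 0 < Module.finrank F (IntermediateField.adjoin F {x}) := Module.finrank_pos
  refine ⟨Nat.pos_of_dvd_of_pos hd (by omega), Nat.Coprime.coprime_dvd_right hd ?_⟩
  have h3 : (Fintype.card (IntermediateField.adjoin F {x})).Coprime
      (Fintype.card (IntermediateField.adjoin F {x}) - 1) := by
    have := Nat.coprime_self_add_left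
      (m := Fintype.card (IntermediateField.adjoin F {x}) - 1) (n := 1)
    rw [Nat.sub_add_cancel hgt.le] at this
    exact this.2 (Nat.coprime_one_left _)
  exact Nat.Coprime.coprime_dvd_left (hc ▸ dvd_pow_self _ hfr.ne') h3

/-- Over a finite field with `q` elements, the degree of the irreducible polynomial of an
element of order `N` divides `k` iff `q ^ k ≡ 1` modulo `N`. -/
lemma natDegree_dvd_iff_card_pow_modEq_one {F L : Type*} [Field F] [Fintype F] [Field L]
    [Algebra F L] {x : L} (hx0 : x ≠ 0) {g : F[X]} (hg : Irreducible g) (hgx : aeval x g = 0)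
    (k : ℕ) : g.natDegree ∣ k ↔ Fintype.card F ^ k ≡ 1 [MOD orderOf x] := by
  obtain ⟨p, hchar⟩ := CharP.exists F
  obtain ⟨e, hp, hcard⟩ := FiniteField.card F p
  have := Fact.mk hp
  have hxint : IsIntegral F x := IsAlgebraic.isIntegral ⟨g, hg.ne_zero, hgx⟩
  obtain ⟨hpos, hcop⟩ := orderOf_pos_and_coprime_card hxint hx0
  have hpc : p.Coprime (orderOf x) := by
    rw [hcard] at hcop
    exact Nat.Coprime.coprime_dvd_left (dvd_pow_self _ e.2.ne') hcop
  have hdvd : g ∣ cyclotomic (orderOf x) F := by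
    rw [← hg.dvd_iff_aeval_eq_zero hgx]
    have := (IsPrimitiveRoot.orderOf x).isRoot_cyclotomic hpos
    rw [IsRoot.def, ← map_cyclotomic (orderOf x) (algebraMap F L), eval_map_algebraMap] at this
    exact this
  rw [natDegree_of_dvd_cyclotomic_of_irreducible hcard hpc hdvd hg, orderOf_dvd_iff_pow_eq_one,
    ← Units.val_inj, Units.val_pow_eq_pow_val, ZMod.coe_unitOfCoprime, Units.val_one, hcard,
    ← Nat.cast_pow, ← Nat.cast_one, ZMod.natCast_eq_natCast_iff]

lemma Nat.ModEq.pow_prime_pow_of_dvd {r e x : ℕ} (hre : r ∣ e) (h : x ≡ 1 [MOD e]) (a : ℕ) :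
    x ^ r ^ a ≡ 1 [MOD e * r ^ a] := by
  rw [← Int.natCast_modEq_iff] at *
  have h' := (Int.modEq_iff_dvd.1 h.symm)
  refine (Int.modEq_iff_dvd.2 ?_).symm
  push_cast at *
  induction a with
  | zero => simpa using h'
  | succ a ih =>
    set y : ℤ := x ^ r ^ a
    have hy : (r : ℤ) ∣ y - 1 :=
      (Int.natCast_dvd_natCast.2 hre).trans ((dvd_mul_right _ _).trans ih)
    have hsum : (r : ℤ) ∣ ∑ i ∈ Finset.range r, y ^ i := by
      have h1 : (r : ℤ) ∣ ∑ i ∈ Finset.range r, (y ^ i - 1) :=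
        Finset.dvd_sum fun i _ => hy.trans (by simpa using sub_dvd_pow_sub_pow y 1 i)
      rw [Finset.sum_sub_distrib] at h1
      simpa using h1
    rw [pow_succ (r : ℕ) a, pow_mul, ← mul_geom_sum, pow_succ, ← mul_assoc]
    exact mul_dvd_mul ih hsum

lemma orderOf_eq_mul_of_pow_eq {G : Type*} [Monoid G] {r a : ℕ} (hr : r.Prime) {x y : G}
    (hxy : x ^ r ^ a = y) (hry : r ∣ orderOf y) :
    orderOf x = orderOf y * r ^ a := by
  have h1 : orderOf y = orderOf x / (orderOf x).gcd (r ^ a) := by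
    rw [← hxy]; exact orderOf_pow' _ (pow_pos hr.pos a).ne'
  obtain ⟨c, hc, hc'⟩ := (Nat.dvd_prime_pow hr).1 (Nat.gcd_dvd_right (orderOf x) (r ^ a))
  have h2 : orderOf y * r ^ c = orderOf x := by
    rw [h1, hc']
    exact Nat.div_mul_cancel (hc' ▸ Nat.gcd_dvd_left _ _)
  rcases hc.eq_or_lt with rfl | hlt
  · exact h2.symm
  · exfalso
    have h3 : r ^ (c + 1) ∣ (orderOf x).gcd (r ^ a) := by
      refine Nat.dvd_gcd ?_ (pow_dvd_pow r hlt)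
      rw [← h2, pow_succ']
      exact mul_dvd_mul_right hry _
    rw [hc', Nat.pow_dvd_pow_iff_le_right hr.one_lt] at h3
    omega

/-- An irreducible polynomial `f ≠ X` over a finite field either has an irreducible factor of
`f(X ^ r ^ a)` of the same degree, or `f(X ^ r ^ a)` is a product of irreducible polynomials
of the same degree `r ^ b * deg f`. -/
lemma exists_factor_natDegree_eq_or_exists_multiset {F : Type*} [Field F] [Fintype F] {r a : ℕ}
    (hr : r.Prime) {f : F[X]} (hfm : f.Monic) (hfi : Irreducible f) (hfX : f ≠ X) :
    (∃ g : F[X], Irreducible g ∧ g ∣ f.comp (X ^ r ^ a) ∧ g.natDegree = f.natDegree) ∨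
    ∃ b, 1 ≤ b ∧ b ≤ a ∧ ∃ s : Multiset F[X], Multiset.card s = r ^ (a - b) ∧
      (∀ g ∈ s, g.Monic ∧ Irreducible g ∧ g.natDegree = r ^ b * f.natDegree) ∧
      f.comp (X ^ r ^ a) = s.prod := by
  classical
  rw [or_iff_not_imp_left]
  intro hnot
  have hM : r ^ a ≠ 0 := (pow_pos hr.pos a).ne'
  have hf0 : ∀ {L : Type _} [Field L] [Algebra F L] (x : L), aeval x f = 0 → x ≠ 0 := by
    rintro L _ _ x hx rfl
    have : X ∣ f := by
      rw [X_dvd_iff, coeff_zero_eq_aeval_zero]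
      rw [← map_zero (algebraMap F L), aeval_algebraMap_apply] at hx
      simpa using hx
    exact not_X_dvd_of_irreducible hfm hfi hfX this
  have hfd : 0 < f.natDegree := hfi.natDegree_pos
  have hroot : ∀ g : F[X], Irreducible g → ∃ x : AlgebraicClosure F, aeval x g = 0 := fun g hg =>
    IsAlgClosed.exists_aeval_eq_zero _ g (degree_pos_of_irreducible hg).ne'
  obtain ⟨y, hy⟩ := hroot f hfi
  have hy0 := hf0 y hy
  have hroot_comp : ∀ g, Irreducible g → g ∣ f.comp (X ^ r ^ a) →
      ∃ x : AlgebraicClosure F, aeval x g = 0 ∧ aeval (x ^ r ^ a) f = 0 := by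
    rintro g hg ⟨w, hw⟩
    obtain ⟨x, hx⟩ := hroot g hg
    refine ⟨x, hx, ?_⟩
    have := congrArg (aeval x) hw
    rw [map_mul, hx, zero_mul, aeval_comp] at this
    simpa using this
  have horder : ∀ z : AlgebraicClosure F, aeval z f = 0 → orderOf z = orderOf y := by
    have h : ∀ {z : AlgebraicClosure F}, aeval z f = 0 → ∀ k, z ^ k = 1 ↔ f ∣ X ^ k - 1 := by
      intro z hz k
      rw [← hfi.dvd_iff_aeval_eq_zero hz]
      simp [sub_eq_zero]
    intro z hz
    exact orderOf_eq_orderOf_iff.2 fun k => (h hz k).trans (h hy k).symm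
  have hry : r ∣ orderOf y := by
    by_contra hry
    have hc : (orderOf y).Coprime (r ^ a) :=
      (Nat.Coprime.pow_left a ((Nat.Prime.coprime_iff_not_dvd hr).2 hry)).symm
    have hyint : IsIntegral F y := Algebra.IsIntegral.isIntegral y
    have hpos := (orderOf_pos_and_coprime_card hyint hy0).1
    obtain ⟨t, ht⟩ := exists_pow_eq_self_of_coprime hc.symm
    have hx0 : y ^ t ≠ 0 := pow_ne_zero _ hy0
    have hxo : orderOf (y ^ t) = orderOf y := by
      apply Nat.dvd_antisymm (orderOf_pow_dvd t)
      conv_lhs => rw [← ht, ← pow_mul, mul_comm, pow_mul]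
      exact orderOf_pow_dvd _
    have hxi : IsIntegral F (y ^ t) := Algebra.IsIntegral.isIntegral _
    refine hnot ⟨minpoly F (y ^ t), minpoly.irreducible hxi, minpoly.dvd _ _ ?_, ?_⟩
    · rw [aeval_comp, map_pow, aeval_X, ← pow_mul, mul_comm, pow_mul, ht, hy]
    · apply Nat.dvd_antisymm
      · rw [natDegree_dvd_iff_card_pow_modEq_one hx0 (minpoly.irreducible hxi) (minpoly.aeval _ _),
          hxo, ← natDegree_dvd_iff_card_pow_modEq_one hy0 hfi hy]
      · rw [natDegree_dvd_iff_card_pow_modEq_one hy0 hfi hy, ← hxo,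
          ← natDegree_dvd_iff_card_pow_modEq_one hx0 (minpoly.irreducible hxi) (minpoly.aeval _ _)]
  have hdeg : ∀ g, Irreducible g → g ∣ f.comp (X ^ r ^ a) → ∀ k, g.natDegree ∣ k ↔
      Fintype.card F ^ k ≡ 1 [MOD orderOf y * r ^ a] := by
    intro g hg hgf k
    obtain ⟨x, hx, hxf⟩ := hroot_comp g hg hgf
    have hx0 : x ≠ 0 := by
      rintro rfl
      exact hf0 _ hxf (zero_pow hM)
    have h1 := horder _ hxf
    rw [natDegree_dvd_iff_card_pow_modEq_one hx0 hg hx k,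
      orderOf_eq_mul_of_pow_eq hr rfl (h1 ▸ hry), h1]
  have hcm : (f.comp (X ^ r ^ a)).Monic := hfm.comp (monic_X_pow _) (by simpa using hM)
  have hcd : (f.comp (X ^ r ^ a)).natDegree = r ^ a * f.natDegree := by
    simp [natDegree_comp, mul_comm]
  obtain ⟨g₀, hg₀, hg₀f⟩ := WfDvdMonoid.exists_irreducible_factor
    (not_isUnit_of_natDegree_pos _ (hcd ▸ Nat.mul_pos (pow_pos hr.pos a) hfd)) hcm.ne_zero
  have heq : ∀ g, Irreducible g → g ∣ f.comp (X ^ r ^ a) → g.natDegree = g₀.natDegree :=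
    fun g hg hgf => Nat.dvd_antisymm ((hdeg g hg hgf _).2 ((hdeg g₀ hg₀ hg₀f _).1 dvd_rfl))
      ((hdeg g₀ hg₀ hg₀f _).2 ((hdeg g hg hgf _).1 dvd_rfl))
  have hd1 : f.natDegree ∣ g₀.natDegree := by
    rw [natDegree_dvd_iff_card_pow_modEq_one hy0 hfi hy]
    exact Nat.ModEq.of_mul_right _ ((hdeg g₀ hg₀ hg₀f _).1 dvd_rfl)
  have hd2 : g₀.natDegree ∣ f.natDegree * r ^ a := by
    rw [hdeg g₀ hg₀ hg₀f, pow_mul]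
    exact Nat.ModEq.pow_prime_pow_of_dvd hry
      ((natDegree_dvd_iff_card_pow_modEq_one hy0 hfi hy _).1 dvd_rfl) a
  obtain ⟨u, hu⟩ := hd1
  rw [hu] at hd2
  obtain ⟨b, hba, rfl⟩ := (Nat.dvd_prime_pow hr).1 (Nat.dvd_of_mul_dvd_mul_left hfd hd2)
  refine ⟨b, ?_, hba, UniqueFactorizationMonoid.normalizedFactors (f.comp (X ^ r ^ a)), ?_, ?_, ?_⟩
  · by_contra hb
    obtain rfl : b = 0 := by omega
    exact hnot ⟨g₀, hg₀, hg₀f, by simpa using hu⟩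
  · have h1 := congrArg natDegree
      (UniqueFactorizationMonoid.prod_normalizedFactors_eq hcm.ne_zero)
    rw [hcm.normalize_eq_self, hcd, natDegree_multiset_prod _
      (UniqueFactorizationMonoid.zero_notMem_normalizedFactors _),
      Multiset.map_congr rfl fun g hg => (heq g
        (UniqueFactorizationMonoid.irreducible_of_normalized_factor g hg)
        (UniqueFactorizationMonoid.dvd_of_mem_normalizedFactors hg)).trans hu,
      Multiset.map_const', Multiset.sum_replicate, smul_eq_mul] at h1
    apply Nat.eq_of_mul_eq_mul_right (Nat.mul_pos hfd (pow_pos hr.pos b))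
    rw [h1, mul_left_comm, ← pow_add, Nat.sub_add_cancel hba, mul_comm]
  · intro g hg
    have hgi := UniqueFactorizationMonoid.irreducible_of_normalized_factor g hg
    refine ⟨?_, hgi, ?_⟩
    · rw [← UniqueFactorizationMonoid.normalize_normalized_factor g hg]
      exact monic_normalize hgi.ne_zero
    · rw [heq g hgi (UniqueFactorizationMonoid.dvd_of_mem_normalizedFactors hg), hu, mul_comm]
  · have := UniqueFactorizationMonoid.prod_normalizedFactors_eq hcm.ne_zero
    rw [this, hcm.normalize_eq_self]

/-- If the irreducible `g` divides `f(X ^ M)`, then `F[X] / g` has a basis of `deg g / deg f`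
elements over `F[X] / f` embedded via `X ↦ X ^ M`; here the basis is lifted to `F[X]`. -/
lemma exists_generators_mod_irreducible {F : Type*} [Field F] {M e : ℕ} {f g : F[X]}
    (hf : Irreducible f) (hg : Irreducible g) (hgf : g ∣ expand F M f)
    (hdeg : g.natDegree = e * f.natDegree) :
    ∃ β : Fin e → F[X], ∀ p : F[X], ∃ v : Fin e → F[X],
      g ∣ p - ∑ i, expand F M (v i) * β i := by
  have := Fact.mk hf
  have := Fact.mk hg
  let φ : AdjoinRoot f →+* AdjoinRoot g := Ideal.quotientMap _ (expand F M).toRingHom (by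
    rw [Ideal.span_singleton_le_iff_mem, Ideal.mem_comap]
    exact Ideal.mem_span_singleton.2 hgf)
  have hφ : ∀ p, φ (AdjoinRoot.mk f p) = AdjoinRoot.mk g (expand F M p) := fun p => rfl
  let : Algebra (AdjoinRoot f) (AdjoinRoot g) := φ.toAlgebra
  have : IsScalarTower F (AdjoinRoot f) (AdjoinRoot g) := by
    refine IsScalarTower.of_algebraMap_eq fun x => ?_
    rw [RingHom.algebraMap_toAlgebra, AdjoinRoot.algebraMap_eq, AdjoinRoot.algebraMap_eq,
      ← AdjoinRoot.mk_C, ← AdjoinRoot.mk_C, hφ, expand_C]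
  have hfr : Module.finrank (AdjoinRoot f) (AdjoinRoot g) = e := by
    have h := Module.finrank_mul_finrank F (AdjoinRoot f) (AdjoinRoot g)
    have h1 : Module.finrank F (AdjoinRoot f) = f.natDegree :=
      finrank_quotient_span_eq_natDegree (f := f)
    have h2 : Module.finrank F (AdjoinRoot g) = g.natDegree :=
      finrank_quotient_span_eq_natDegree (f := g)
    rw [h1, h2, hdeg, mul_comm] at h
    exact Nat.eq_of_mul_eq_mul_right hf.natDegree_pos h
  have hfin : Module.Finite F (AdjoinRoot g) := (AdjoinRoot.powerBasis hg.ne_zero).finite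
  have : Module.Finite (AdjoinRoot f) (AdjoinRoot g) := Module.Finite.of_restrictScalars_finite F _ _
  let b := Module.finBasisOfFinrankEq (AdjoinRoot f) (AdjoinRoot g) hfr
  choose β hβ using fun i => AdjoinRoot.mk_surjective (b i)
  refine ⟨β, fun p => ?_⟩
  choose v hv using fun i => AdjoinRoot.mk_surjective (b.repr (AdjoinRoot.mk g p) i)
  refine ⟨v, ?_⟩
  rw [← AdjoinRoot.mk_eq_zero, map_sub, sub_eq_zero]
  conv_lhs => rw [← b.sum_repr (AdjoinRoot.mk g p)]
  rw [map_sum]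
  refine Finset.sum_congr rfl fun i _ => ?_
  rw [Algebra.smul_def, RingHom.algebraMap_toAlgebra, ← hv, hφ, map_mul, hβ]

/-- If `g` is irreducible and divides `f(X ^ M)` exactly once, then `F[X] / g ^ k`, with `X` acting
as `X ^ M`, is a direct sum of copies of `F[X] / f ^ k`. -/
lemma exists_linearEquiv_pi_quotient_pow {F : Type*} [Field F] {M e : ℕ} {f g w : F[X]}
    (hf : Irreducible f) (hg : Irreducible g) (hgf : expand F M f = g * w) (hgw : IsCoprime g w)
    (hdeg : g.natDegree = e * f.natDegree) (k : ℕ) :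
    ∃ Ψ : (Fin e → F[X] ⧸ Ideal.span {f ^ k}) ≃ₗ[F] (F[X] ⧸ Ideal.span {g ^ k}),
      ∀ v, Ψ ((X : F[X]) • v) = (X : F[X]) ^ M • Ψ v := by
  obtain ⟨β, hβ⟩ := exists_generators_mod_irreducible hf hg (Dvd.intro w hgf.symm) hdeg
  let ψ : F[X] ⧸ Ideal.span {f ^ k} →ₐ[F] F[X] ⧸ Ideal.span {g ^ k} :=
    Ideal.quotientMapₐ _ (expand F M) (by
      rw [Ideal.span_singleton_le_iff_mem, Ideal.mem_comap]
      refine Ideal.mem_span_singleton.2 ?_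
      rw [map_pow, hgf]
      exact pow_dvd_pow_of_dvd (dvd_mul_right _ _) k)
  let q := Ideal.Quotient.mk (Ideal.span {g ^ k})
  have hψ : ∀ p, ψ (Ideal.Quotient.mk _ p) = q (expand F M p) := fun p => rfl
  let Ψ : (Fin e → F[X] ⧸ Ideal.span {f ^ k}) →ₗ[F] (F[X] ⧸ Ideal.span {g ^ k}) :=
    ∑ i, LinearMap.mulRight F (q (β i)) ∘ₗ ψ.toLinearMap ∘ₗ LinearMap.proj i
  have hΨ : ∀ v, Ψ v = ∑ i, ψ (v i) * q (β i) := fun v => by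
    simp [Ψ, LinearMap.sum_apply]
  obtain ⟨u, t, hut⟩ := (hgw.pow_left (m := k)).symm
  have hstep : ∀ n (p : F[X]), ∃ (v : Fin e → F[X]) (c : F[X]),
      q p = ∑ i, q (expand F M (v i)) * q (β i) + q (expand F M f) ^ n * q c := by
    intro n p
    induction n with
    | zero => exact ⟨0, p, by simp⟩
    | succ n ih =>
      obtain ⟨v, c, h⟩ := ih
      obtain ⟨v', c', h'⟩ := hβ c
      have hqg : q g ^ k = 0 := by
        rw [← map_pow]
        exact Ideal.Quotient.eq_zero_iff_mem.2 (Ideal.mem_span_singleton_self _)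
      have h1 : q u * q w = 1 := by
        have := congrArg q hut
        simpa [hqg] using this
      refine ⟨fun i => v i + f ^ n * v' i, u * c', ?_⟩
      have hc : q c = ∑ i, q (expand F M (v' i)) * q (β i) + q (expand F M f) * (q u * q c') := by
        have := congrArg q (sub_eq_iff_eq_add'.1 h')
        rw [this, hgf]
        simp only [map_add, map_sum, map_mul]
        linear_combination (-q g * q c') * h1
      rw [h, hc]
      simp only [map_add, map_mul, map_pow, add_mul, Finset.sum_add_distrib, mul_add,
        Finset.mul_sum, mul_assoc, pow_succ]
      ring
  have hsurj : Function.Surjective Ψ := by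
    intro y
    obtain ⟨p, rfl⟩ := Ideal.Quotient.mk_surjective y
    obtain ⟨v, c, h⟩ := hstep k p
    refine ⟨fun i => Ideal.Quotient.mk _ (v i), ?_⟩
    have h0 : q (expand F M f) ^ k = 0 := by
      rw [hgf, ← map_pow, mul_pow]
      exact Ideal.Quotient.eq_zero_iff_mem.2
        (Ideal.mul_mem_right _ _ (Ideal.mem_span_singleton_self _))
    rw [h0, zero_mul, add_zero] at h
    rw [hΨ]
    exact h.symm
  have hfin : ∀ {p : F[X]}, Irreducible p → Module.Finite F (F[X] ⧸ Ideal.span {p ^ k}) :=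
    fun hp => (AdjoinRoot.powerBasis (pow_ne_zero k hp.ne_zero)).finite
  have := hfin hf
  have := hfin hg
  have hfr : Module.finrank F (Fin e → F[X] ⧸ Ideal.span {f ^ k}) =
      Module.finrank F (F[X] ⧸ Ideal.span {g ^ k}) := by
    rw [Module.finrank_pi_fintype]
    simp only [finrank_quotient_span_eq_natDegree, natDegree_pow, hdeg]
    simp; ring
  have hbij : Function.Bijective Ψ :=
    ⟨(LinearMap.injective_iff_surjective_of_finrank_eq_finrank hfr).2 hsurj, hsurj⟩
  refine ⟨LinearEquiv.ofBijective Ψ hbij, fun v => ?_⟩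
  rw [LinearEquiv.ofBijective_apply, LinearEquiv.ofBijective_apply, hΨ, hΨ, Finset.smul_sum]
  refine Finset.sum_congr rfl fun i _ => ?_
  obtain ⟨p, hp⟩ := Ideal.Quotient.mk_surjective (v i)
  have hsmul : ∀ (a r : F[X]) (y : F[X] ⧸ Ideal.span {r}), a • y = Ideal.Quotient.mk _ a * y :=
    fun a r y => Algebra.smul_def a y
  rw [Pi.smul_apply, ← hp, hsmul, hsmul, ← map_mul, hψ, hψ, map_mul, expand_X, map_mul, mul_assoc]

/-- If `f` is separable and prime to `X`, and `M` is invertible, then `f(X ^ M)` is separable. -/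
lemma separable_expand {F : Type*} [Field F] {M : ℕ} (hM : (M : F) ≠ 0)
    {f : F[X]} (hfs : f.Separable) (hfX : ¬ X ∣ f) :
    (expand F M f).Separable := by
  have hM0 : M ≠ 0 := by rintro rfl; simp at hM
  rw [Polynomial.separable_def, derivative_expand]
  have h1 : IsCoprime (expand F M f) (expand F M (derivative f)) :=
    IsCoprime.map hfs (expand F M).toRingHom
  refine h1.mul_right (IsCoprime.mul_right ?_ (IsCoprime.pow_right ?_))
  · rw [← map_natCast C]
    exact isCoprime_one_right.of_isCoprime_of_dvd_right (isUnit_C.2 hM.isUnit).dvd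
  · refine ((irreducible_X.coprime_iff_not_dvd).2 ?_).symm
    rw [X_dvd_iff, coeff_zero_eq_eval_zero, expand_eval, zero_pow hM0, ← coeff_zero_eq_eval_zero,
      ← X_dvd_iff]
    exact hfX

lemma LinearEquiv.conj_pow {R N N' : Type*} [CommSemiring R] [AddCommMonoid N] [Module R N]
    [AddCommMonoid N'] [Module R N'] (e : N ≃ₗ[R] N') (T : Module.End R N) (k : ℕ) :
    e.conj (T ^ k) = e.conj T ^ k :=
  map_pow e.conjRingEquiv T k

/-- The module `N` admits a linear `M`-th root of the multiplication by `X`. -/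
def HasRootOfX (F : Type*) [Field F] (M : ℕ) (N : Type*) [AddCommMonoid N] [Module F N]
    [Module F[X] N] : Prop :=
  ∃ T : Module.End F N, ∀ x, (T ^ M) x = (X : F[X]) • x

namespace HasRootOfX

variable {F : Type*} [Field F] {M : ℕ}

lemma of_linearEquiv {N N' : Type*} [AddCommMonoid N] [Module F N] [Module F[X] N]
    [AddCommMonoid N'] [Module F N'] [Module F[X] N'] (e : N ≃ₗ[F] N')
    (he : ∀ x, e ((X : F[X]) • x) = (X : F[X]) • e x) (h : HasRootOfX F M N) :
    HasRootOfX F M N' := by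
  obtain ⟨T, hT⟩ := h
  refine ⟨e.conj T, fun x => ?_⟩
  rw [← LinearEquiv.conj_pow, LinearEquiv.conj_apply_apply, hT, he, e.apply_symm_apply]

lemma directSum {ι : Type*} {N : ι → Type*} [∀ i, AddCommMonoid (N i)] [∀ i, Module F (N i)]
    [∀ i, Module F[X] (N i)] (h : ∀ i, HasRootOfX F M (N i)) : HasRootOfX F M (⨁ i, N i) := by
  choose T hT using h
  refine ⟨DirectSum.lmap T, fun x => ?_⟩
  have : ∀ k (x : ⨁ i, N i) i, ((DirectSum.lmap T ^ k) x) i = (T i ^ k) (x i) := by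
    intro k
    induction k with
    | zero => intro x i; rfl
    | succ k ih => intro x i; rw [pow_succ, Module.End.mul_apply, ih, pow_succ]; rfl
  ext i
  rw [this, hT]; rfl

lemma pi {ι : Type*} {N : ι → Type*} [∀ i, AddCommMonoid (N i)] [∀ i, Module F (N i)]
    [∀ i, Module F[X] (N i)] (h : ∀ i, HasRootOfX F M (N i)) : HasRootOfX F M (∀ i, N i) := by
  choose T hT using h
  refine ⟨LinearMap.piMap T, fun x => ?_⟩
  have : ∀ k (x : ∀ i, N i) i, ((LinearMap.piMap T ^ k) x) i = (T i ^ k) (x i) := by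
    intro k
    induction k with
    | zero => intro x i; rfl
    | succ k ih => intro x i; rw [pow_succ, Module.End.mul_apply, ih, pow_succ]; rfl
  ext i
  rw [this, hT]; rfl

end HasRootOfX

lemma hasRootOfX_pi_of_linearEquiv {F : Type*} [Field F] {M e c : ℕ} {f g : F[X]} {k : ℕ}
    (Ψ : (Fin e → F[X] ⧸ Ideal.span {f ^ k}) ≃ₗ[F] (F[X] ⧸ Ideal.span {g ^ k}))
    (hΨ : ∀ v, Ψ ((X : F[X]) • v) = (X : F[X]) ^ M • Ψ v) :
    HasRootOfX F M (Fin (e * c) → F[X] ⧸ Ideal.span {f ^ k}) := by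
  have h1 : HasRootOfX F M (Fin e → F[X] ⧸ Ideal.span {f ^ k}) := by
    refine ⟨Ψ.symm.conj (Algebra.lsmul F F (F[X] ⧸ Ideal.span {g ^ k}) (X : F[X])), fun v => ?_⟩
    rw [← LinearEquiv.conj_pow, LinearEquiv.conj_apply_apply, ← map_pow, Algebra.lsmul_coe,
      LinearEquiv.symm_symm, LinearEquiv.symm_apply_eq]
    exact (hΨ v).symm
  have h2 : HasRootOfX F M (Fin c → Fin e → F[X] ⧸ Ideal.span {f ^ k}) := .pi fun _ => h1
  let ε : Fin (e * c) ≃ Fin c × Fin e := (finCongr (mul_comm e c)).trans finProdFinEquiv.symm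
  exact h2.of_linearEquiv
    ((LinearEquiv.curry F (F[X] ⧸ Ideal.span {f ^ k}) (Fin c) (Fin e)).symm ≪≫ₗ
      LinearEquiv.funCongrLeft F (F[X] ⧸ Ideal.span {f ^ k}) ε) fun _ => rfl

/-- An invertible matrix `α` is an `M`-th power as soon as `X` has an `M`-th root on the module
defined by `α`. -/
lemma exists_pow_eq_of_hasRootOfX {F : Type*} [Field F] {n M : ℕ} (hM : M ≠ 0) (α : GL (Fin n) F)
    (h : HasRootOfX F M (Module.AEval' (Matrix.mulVecLin (α : Matrix (Fin n) (Fin n) F)))) :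
    ∃ β : GL (Fin n) F, β ^ M = α := by
  obtain ⟨T, hT⟩ := h
  let φ := Matrix.mulVecLin (α : Matrix (Fin n) (Fin n) F)
  let e := Module.AEval'.of φ
  have h1 : (e.symm.conj T) ^ M = Matrix.toLin' (α : Matrix (Fin n) (Fin n) F) := by
    refine LinearMap.ext fun v => ?_
    rw [← LinearEquiv.conj_pow, LinearEquiv.conj_apply_apply, hT, LinearEquiv.symm_symm]
    exact (LinearEquiv.symm_apply_eq e).2 (Module.AEval'.X_smul_of φ v)
  have h2 : LinearMap.toMatrixAlgEquiv' (e.symm.conj T) ^ M = (α : Matrix (Fin n) (Fin n) F) := by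
    rw [← map_pow, h1]
    exact LinearMap.toMatrix'_toLin' _
  have h3 : IsUnit (LinearMap.toMatrixAlgEquiv' (e.symm.conj T)) := by
    rw [← isUnit_pow_iff hM, h2]
    exact α.isUnit
  obtain ⟨β, hβ⟩ := h3
  exact ⟨β, Units.ext (by rw [Units.val_pow_eq_pow_val, hβ, h2])⟩

/-- A module killed by a product of irreducible polynomials of degree `D` has dimension divisible
by `D`. -/
lemma dvd_finrank_of_multiset_prod_smul_eq_zero {F : Type*} [Field F] {D : ℕ}
    (s : Multiset F[X]) (hs : ∀ g ∈ s, Irreducible g ∧ g.natDegree = D) {N : Type*}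
    [AddCommGroup N] [Module F N] [Module F[X] N] [IsScalarTower F F[X] N] [Module.Finite F N]
    (hN : ∀ x : N, s.prod • x = 0) : D ∣ Module.finrank F N := by
  induction s using Multiset.induction_on generalizing N with
  | empty =>
    have : Subsingleton N := ⟨fun x y => by simpa using (hN x).trans (hN y).symm⟩
    rw [Module.finrank_zero_of_subsingleton]
    exact dvd_zero D
  | cons g s ih =>
    obtain ⟨hg, hgD⟩ := hs g (Multiset.mem_cons_self g s)
    let φ : N →ₗ[F[X]] N := LinearMap.lsmul F[X] N g
    rw [← LinearMap.finrank_range_add_finrank_ker (φ.restrictScalars F)]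
    refine dvd_add ?_ ?_
    · have : Module.Finite F (LinearMap.range φ) :=
        inferInstanceAs (Module.Finite F (LinearMap.range (φ.restrictScalars F)))
      refine ih (fun g hg => hs g (Multiset.mem_cons_of_mem hg)) (N := LinearMap.range φ) ?_
      rintro ⟨_, x, rfl⟩
      refine Subtype.ext ?_
      have := hN x
      rwa [Multiset.prod_cons, mul_comm, mul_smul] at this
    · have : Module.Finite F (LinearMap.ker φ) :=
        inferInstanceAs (Module.Finite F (LinearMap.ker (φ.restrictScalars F)))
      have htor : Module.IsTorsionBySet F[X] (LinearMap.ker φ) (Ideal.span {g}) := by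
        rw [Module.isTorsionBySet_span_singleton_iff]
        exact fun x => Subtype.ext x.2
      have := Fact.mk hg
      let : Module (AdjoinRoot g) (LinearMap.ker φ) := htor.module
      have : IsScalarTower F (AdjoinRoot g) (LinearMap.ker φ) := htor.isScalarTower
      have h := Module.finrank_mul_finrank F (AdjoinRoot g) (LinearMap.ker φ)
      have h1 : Module.finrank F (AdjoinRoot g) = D := by
        rw [← hgD]; exact finrank_quotient_span_eq_natDegree (f := g)
      rw [h1] at h
      exact Dvd.intro _ h

/-- The kernel of `φ` intersected with the range of `φ ^ j`. -/
def kerInfRangePow {F V : Type*} [Field F] [AddCommMonoid V] [Module F V] (φ : Module.End F V)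
    (j : ℕ) : Submodule F V :=
  LinearMap.ker φ ⊓ LinearMap.range (φ ^ j)

section

variable {F V W : Type*} [Field F] [AddCommGroup V] [Module F V] [AddCommGroup W] [Module F W]

lemma mem_kerInfRangePow {φ : Module.End F V} {j : ℕ} {x : V} :
    x ∈ kerInfRangePow φ j ↔ φ x = 0 ∧ ∃ y, (φ ^ j) y = x := Iff.rfl

lemma finrank_kerInfRangePow_of_semiconj {φ : Module.End F V} {ψ : Module.End F W} (e : V ≃ₗ[F] W)
    (he : ∀ x, e (φ x) = ψ (e x)) (j : ℕ) :
    Module.finrank F (kerInfRangePow φ j) = Module.finrank F (kerInfRangePow ψ j) := by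
  have hpow : ∀ k x, e ((φ ^ k) x) = (ψ ^ k) (e x) := by
    intro k
    induction k with
    | zero => intro x; rfl
    | succ k ih => intro x; rw [pow_succ, Module.End.mul_apply, ih, he, pow_succ]; rfl
  have : (kerInfRangePow φ j).map (e : V →ₗ[F] W) = kerInfRangePow ψ j := by
    ext y
    obtain ⟨x, rfl⟩ := e.surjective y
    rw [Submodule.mem_map_equiv, e.symm_apply_apply, mem_kerInfRangePow, mem_kerInfRangePow,
      ← he, map_eq_zero_iff e e.injective, e.surjective.exists]
    simp only [← hpow, e.injective.eq_iff]
  rw [← this]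
  exact (LinearEquiv.finrank_map_eq e _).symm

lemma dvd_finrank_kerInfRangePow {N : Type*} [AddCommGroup N] [Module F N] [Module F[X] N]
    [IsScalarTower F F[X] N] [Module.Finite F N] {D : ℕ} {s : Multiset F[X]}
    (hs : ∀ g ∈ s, Irreducible g ∧ g.natDegree = D) (j : ℕ) :
    D ∣ Module.finrank F (kerInfRangePow (Algebra.lsmul F F N s.prod) j) := by
  let U : Submodule F[X] N := LinearMap.ker (LinearMap.lsmul F[X] N s.prod) ⊓
    LinearMap.range (LinearMap.lsmul F[X] N (s.prod ^ j))
  have hU : U.restrictScalars F = kerInfRangePow (Algebra.lsmul F F N s.prod) j := by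
    ext x
    rw [mem_kerInfRangePow, ← map_pow]
    rfl
  rw [← hU]
  have : Module.Finite F U := inferInstanceAs (Module.Finite F (U.restrictScalars F))
  exact dvd_finrank_of_multiset_prod_smul_eq_zero s hs (N := U) fun x => Subtype.ext x.2.1

end

lemma DirectSum.exists_smul_eq {R ι : Type*} [Semiring R] {N : ι → Type*}
    [∀ i, AddCommMonoid (N i)] [∀ i, Module R (N i)] {p : R} {x : ⨁ i, N i}
    (h : ∀ i, ∃ y, p • y = x i) : ∃ y, p • y = x := by
  classical
  have h' : ∀ i, ∀ z : N i, ∃ y, (z = 0 → y = 0) ∧ ((∃ y, p • y = z) → p • y = z) := by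
    intro i z
    by_cases hz : z = 0
    · exact ⟨0, fun _ => rfl, fun _ => by simp [hz]⟩
    · by_cases hy : ∃ y, p • y = z
      · exact ⟨hy.choose, fun h => (hz h).elim, fun _ => hy.choose_spec⟩
      · exact ⟨0, fun _ => rfl, fun h => (hy h).elim⟩
  choose c hc0 hc using h'
  refine ⟨DFinsupp.mapRange c (fun i => hc0 i 0 rfl) x, ?_⟩
  ext i
  exact hc i (x i) (h i)

lemma exists_pow_smul_eq_of_smul_eq_zero {F : Type*} [Field F] {f : F[X]} (hf : f ≠ 0) {k : ℕ}
    {z : F[X] ⧸ Ideal.span {f ^ (k + 1)}} (hz : f • z = 0) : ∃ y, f ^ k • y = z := by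
  obtain ⟨p, rfl⟩ := Ideal.Quotient.mk_surjective z
  have h : f ^ (k + 1) ∣ f * p := Ideal.mem_span_singleton.1 (Ideal.Quotient.eq_zero_iff_mem.1 hz)
  rw [pow_succ', mul_dvd_mul_iff_left hf] at h
  obtain ⟨c, rfl⟩ := h
  exact ⟨Ideal.Quotient.mk _ c, rfl⟩

lemma pow_smul_quotient_eq_zero {F : Type*} [Field F] {f : F[X]} {k l : ℕ} (h : k ≤ l)
    (z : F[X] ⧸ Ideal.span {f ^ k}) : f ^ l • z = 0 := by
  obtain ⟨p, rfl⟩ := Ideal.Quotient.mk_surjective z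
  exact Ideal.Quotient.eq_zero_iff_mem.2
    (Ideal.mul_mem_right p _ (Ideal.mem_span_singleton.2 (pow_dvd_pow f h)))

lemma eq_zero_of_smul_quotient_eq_zero {F : Type*} [Field F] {f g : F[X]} (h : IsCoprime f g)
    {z : F[X] ⧸ Ideal.span {g}} (hz : f • z = 0) : z = 0 := by
  obtain ⟨p, rfl⟩ := Ideal.Quotient.mk_surjective z
  have hdiv : g ∣ f * p := Ideal.mem_span_singleton.1 (Ideal.Quotient.eq_zero_iff_mem.1 hz)
  exact Ideal.Quotient.eq_zero_iff_mem.2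
    (Ideal.mem_span_singleton.2 (h.symm.dvd_of_dvd_mul_left hdiv))

/-- The kernel of multiplication by `f` on `(F[X] / f ^ (k + 1)) ^ m` has dimension `m * deg f`. -/
lemma finrank_ker_smul_pi_quotient_pow {F : Type*} [Field F] {f : F[X]} (hf : f ≠ 0) (k m : ℕ)
    (S : Submodule F (Fin m → F[X] ⧸ Ideal.span {f ^ (k + 1)})) (hS : ∀ z, z ∈ S ↔ f • z = 0) :
    Module.finrank F S = m * f.natDegree := by
  let ψ : (F[X] ⧸ Ideal.span {f}) →ₗ[F[X]] (F[X] ⧸ Ideal.span {f ^ (k + 1)}) :=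
    Submodule.mapQ _ _ (LinearMap.lsmul F[X] F[X] (f ^ k)) (by
      rw [Ideal.span, Submodule.span_singleton_le_iff_mem]
      exact Ideal.mem_span_singleton.2 (dvd_of_eq (pow_succ f k)))
  have hψ : ∀ p, ψ (Ideal.Quotient.mk _ p) = Ideal.Quotient.mk _ (f ^ k * p) := fun p => rfl
  have hinj : Function.Injective ψ := by
    rw [injective_iff_map_eq_zero]
    intro x hx
    obtain ⟨p, rfl⟩ := Ideal.Quotient.mk_surjective x
    have h := Ideal.mem_span_singleton.1 (Ideal.Quotient.eq_zero_iff_mem.1 hx)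
    rw [pow_succ] at h
    replace h := (mul_dvd_mul_iff_left (pow_ne_zero k hf)).1 h
    exact Ideal.Quotient.eq_zero_iff_mem.2 (Ideal.mem_span_singleton.2 h)
  let Ψ : (Fin m → F[X] ⧸ Ideal.span {f}) →ₗ[F] (Fin m → F[X] ⧸ Ideal.span {f ^ (k + 1)}) :=
    LinearMap.piMap fun _ => ψ.restrictScalars F
  have hΨ : Function.Injective Ψ := fun x y h => funext fun i => hinj (congrFun h i)
  have hrange : S = LinearMap.range Ψ := by
    ext z
    rw [hS]
    constructor
    · intro hz
      choose y hy using fun i => exists_pow_smul_eq_of_smul_eq_zero hf (congrFun hz i)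
      choose p hp using fun i => Ideal.Quotient.mk_surjective (y i)
      refine ⟨fun i => Ideal.Quotient.mk _ (p i), funext fun i => ?_⟩
      rw [← hy, ← hp]
      rfl
    · rintro ⟨y, rfl⟩
      refine funext fun i => ?_
      obtain ⟨p, hp⟩ := Ideal.Quotient.mk_surjective (y i)
      have : Ψ y i = f ^ k • Ideal.Quotient.mk _ p := by
        change ψ (y i) = _
        rw [← hp]; rfl
      rw [Pi.smul_apply, this, smul_smul, ← pow_succ']
      exact pow_smul_quotient_eq_zero le_rfl _
  have : Module.Finite F (F[X] ⧸ Ideal.span {f}) := (AdjoinRoot.powerBasis hf).finite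
  rw [hrange, LinearMap.finrank_range_of_inj hΨ, Module.finrank_pi_fintype]
  simp [finrank_quotient_span_eq_natDegree]

lemma finrank_kerInfRangePow_directSum {F ι : Type*} [Field F] {f : ι → F[X]}
    (hf : ∀ i, f i ≠ 0) (hcop : Pairwise fun i j => IsCoprime (f i) (f j)) (m : ι → ℕ → ℕ)
    {N : Type*} [AddCommGroup N] [Module F N] [Module F[X] N] [IsScalarTower F F[X] N]
    [Module.Finite F N]
    (e : N ≃ₗ[F[X]] ⨁ i, ⨁ j : ℕ, (Fin (m i j) → F[X] ⧸ Ideal.span {f i ^ (j + 1)}))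
    (i : ι) (j : ℕ) :
    Module.finrank F (kerInfRangePow (Algebra.lsmul F F N (f i)) j) = m i j * (f i).natDegree +
      Module.finrank F (kerInfRangePow (Algebra.lsmul F F N (f i)) (j + 1)) := by
  classical
  have hmem : ∀ k (x : N), x ∈ kerInfRangePow (Algebra.lsmul F F N (f i)) k ↔
      f i • x = 0 ∧ ∃ y : N, f i ^ k • y = x := by
    intro k x
    rw [mem_kerInfRangePow, ← map_pow]
    rfl
  let π : N →ₗ[F[X]] (Fin (m i j) → F[X] ⧸ Ideal.span {f i ^ (j + 1)}) :=
    DirectSum.component F[X] ℕ _ j ∘ₗ DirectSum.component F[X] ι _ i ∘ₗ e.toLinearMap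
  let ρ := (π.restrictScalars F).domRestrict (kerInfRangePow (Algebra.lsmul F F N (f i)) j)
  have hle : kerInfRangePow (Algebra.lsmul F F N (f i)) (j + 1) ≤
      kerInfRangePow (Algebra.lsmul F F N (f i)) j := by
    intro x hx
    rw [hmem] at hx ⊢
    obtain ⟨hx0, y, hy⟩ := hx
    exact ⟨hx0, f i • y, by rw [smul_smul, ← pow_succ, hy]⟩
  have hker : LinearMap.ker ρ = (kerInfRangePow (Algebra.lsmul F F N (f i)) (j + 1)).comap
      (kerInfRangePow (Algebra.lsmul F F N (f i)) j).subtype := by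
    ext ⟨x, hx⟩
    rw [LinearMap.mem_ker, Submodule.mem_comap, Submodule.subtype_apply, hmem]
    change π x = 0 ↔ _
    rw [hmem] at hx
    obtain ⟨hx0, y, hy⟩ := hx
    have hx0' : ∀ i' j' t, f i • e x i' j' t = 0 := fun i' j' t => by
      have := congrArg (fun z : N => e z i' j' t) hx0
      simp only [map_smul, map_zero] at this
      exact this
    constructor
    · intro h
      suffices h : ∃ y, f i ^ (j + 1) • y = e x by
        obtain ⟨y, hy⟩ := h
        exact ⟨hx0, e.symm y, by rw [← map_smul, hy, e.symm_apply_apply]⟩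
      refine DirectSum.exists_smul_eq fun i' => DirectSum.exists_smul_eq fun j' => ?_
      have : ∀ t, ∃ y, f i ^ (j + 1) • y = e x i' j' t := by
        intro t
        by_cases hi : i = i'
        · subst hi
          rcases lt_trichotomy j' j with hj | rfl | hj
          · refine ⟨0, ?_⟩
            rw [smul_zero, ← hy, map_smul]
            exact (pow_smul_quotient_eq_zero (Nat.succ_le_of_lt hj) (e y i j' t)).symm
          · refine ⟨0, ?_⟩
            rw [smul_zero]
            exact (congrFun h t).symm
          · obtain ⟨z, hz⟩ := exists_pow_smul_eq_of_smul_eq_zero (hf i) (hx0' i j' t)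
            refine ⟨f i ^ (j' - (j + 1)) • z, ?_⟩
            rw [smul_smul, ← pow_add, Nat.add_sub_cancel' hj, hz]
        · refine ⟨0, ?_⟩
          rw [smul_zero]
          exact (eq_zero_of_smul_quotient_eq_zero (hcop hi).pow_right (hx0' i' j' t)).symm
      choose y hy using this
      exact ⟨y, funext hy⟩
    · rintro ⟨-, y, hy⟩
      change _ = x at hy
      rw [← hy, map_smul]
      exact funext fun t => pow_smul_quotient_eq_zero le_rfl _
  have hrange : ∀ z, z ∈ LinearMap.range ρ ↔ f i • z = 0 := by
    intro z
    constructor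
    · rintro ⟨⟨x, hx⟩, rfl⟩
      change f i • π x = 0
      rw [← map_smul, ((hmem _ _).1 hx).1, map_zero]
    · intro hz
      choose y hy using fun t => exists_pow_smul_eq_of_smul_eq_zero (hf i) (congrFun hz t)
      have hy' : f i ^ j • y = z := funext hy
      let L : (Fin (m i j) → F[X] ⧸ Ideal.span {f i ^ (j + 1)}) →ₗ[F[X]] N :=
        e.symm.toLinearMap ∘ₗ DirectSum.lof F[X] ι _ i ∘ₗ
          DirectSum.lof F[X] ℕ (fun j => Fin (m i j) → F[X] ⧸ Ideal.span {f i ^ (j + 1)}) j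
      have hL : ∀ z, π (L z) = z := fun z => by
        simp [π, L, DirectSum.component.lof_self]
      refine ⟨⟨L z, (hmem _ _).2 ⟨?_, L y, ?_⟩⟩, hL z⟩
      · rw [← map_smul, hz, map_zero]
      · rw [← map_smul, hy']
  rw [← LinearMap.finrank_range_add_finrank_ker ρ,
    finrank_ker_smul_pi_quotient_pow (hf i) j (m i j) _ hrange, hker,
    (Submodule.comapSubtypeEquivOfLe hle).finrank_eq]

lemma natCast_ne_zero_of_coprime_card {F : Type*} [Field F] [Fintype F] {M : ℕ}
    (h : (Fintype.card F).Coprime M) : (M : F) ≠ 0 := by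
  intro h0
  obtain ⟨p, hp⟩ := CharP.exists F
  have h1 : p ∣ (Fintype.card F).gcd M := Nat.dvd_gcd
    ((CharP.cast_eq_zero_iff F p _).1 (FiniteField.cast_card_eq_zero F))
    ((CharP.cast_eq_zero_iff F p _).1 h0)
  rw [h] at h1
  exact CharP.ringChar_ne_one (R := F) ((CharP.eq F (ringChar.charP F) hp).trans (Nat.dvd_one.1 h1))

/-- If `f(X ^ M)` has an irreducible factor of degree `e * deg f`, then `X` has an `M`-th root on
every direct sum of a multiple of `e` copies of `F[X] / f ^ k`. -/
lemma hasRootOfX_pi_of_dvd_comp {F : Type*} [Field F] [Fintype F] {M e m : ℕ}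
    (hcop : (Fintype.card F).Coprime M) {f g : F[X]} (hfm : f.Monic) (hfi : Irreducible f)
    (hfX : f ≠ X) (hg : Irreducible g) (hgf : g ∣ f.comp (X ^ M))
    (hdeg : g.natDegree = e * f.natDegree) (hm : e ∣ m) (k : ℕ) :
    HasRootOfX F M (Fin m → F[X] ⧸ Ideal.span {f ^ k}) := by
  rw [← expand_eq_comp_X_pow] at hgf
  obtain ⟨w, hw⟩ := hgf
  obtain ⟨c, rfl⟩ := hm
  have hsep := separable_expand (natCast_ne_zero_of_coprime_card hcop)
    (PerfectField.separable_of_irreducible hfi) (not_X_dvd_of_irreducible hfm hfi hfX)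
  rw [hw] at hsep
  obtain ⟨Ψ, hΨ⟩ := exists_linearEquiv_pi_quotient_pow hfi hg hw hsep.isCoprime hdeg k
  exact hasRootOfX_pi_of_linearEquiv Ψ hΨ

lemma finrank_kerInfRangePow_aeval'_pow {F V : Type*} [Field F] [AddCommGroup V] [Module F V]
    {φ ψ : Module.End F V} {M : ℕ} (h : ψ ^ M = φ) (f : F[X]) (j : ℕ) :
    Module.finrank F (kerInfRangePow (Algebra.lsmul F F (Module.AEval' φ) f) j) =
    Module.finrank F (kerInfRangePow (Algebra.lsmul F F (Module.AEval' ψ) (f.comp (X ^ M))) j) := by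
  refine finrank_kerInfRangePow_of_semiconj
    ((Module.AEval'.of φ).symm ≪≫ₗ Module.AEval'.of ψ) (fun x => ?_) j
  change Module.AEval'.of ψ ((Module.AEval.of F V φ).symm (f • x)) =
    f.comp (X ^ M) • Module.AEval.of F V ψ ((Module.AEval.of F V φ).symm x)
  rw [Module.AEval.of_symm_smul, ← Module.AEval.of_aeval_smul, aeval_comp, map_pow, aeval_X, h]

/-- Let `M = r^a` with `r` prime, `gcd(q,M) = 1`, and `α ∈ GL(n, F_q)` with
`F_q^n`, as an `F_q[X]`-module via `α`, isomorphic to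
`⊕_i ⊕_{j ≥ 1} (F_q[X]/(f_i^j))^{⊕ m_{ij}}` (here `m i j` is the multiplicity of exponent
`j+1`), where the `f_i` are distinct monic irreducible polynomials `≠ X`.  Then `X^M = α`
has a solution in `GL(n, F_q)` iff for each `i` either `f_i` is an M-power polynomial, or
`f_i ∈ Φ_{M,b}` for some `1 ≤ b ≤ a` (i.e. `f_i(X^M)` is a product of `r^{a−b}` irreducible
polynomials each of degree `r^b · deg f_i`) and `r^b` divides every multiplicity `m_{ij}`. -/
theorem statement8 (F : Type*) [Field F] [Fintype F] (r a M : ℕ) (hr : r.Prime) (ha : 1 ≤ a)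
    (hMra : M = r ^ a) (hcop : Nat.Coprime (Fintype.card F) M)
    (n : ℕ) (α : GL (Fin n) F)
    (l : ℕ) (hl : 0 < l) (f : Fin l → F[X]) (hinj : Function.Injective f)
    (hf : ∀ i, (f i).Monic ∧ Irreducible (f i) ∧ f i ≠ X)
    (m : Fin l → ℕ → ℕ) (hm : ∀ i, ∃ j, 0 < m i j)
    (hiso : Nonempty ((Module.AEval' (Matrix.mulVecLin (α : Matrix (Fin n) (Fin n) F)))
      ≃ₗ[F[X]] ⨁ i : Fin l, ⨁ j : ℕ, (Fin (m i j) → F[X] ⧸ Ideal.span {f i ^ (j + 1)}))) :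
    (∃ β : GL (Fin n) F, β ^ M = α) ↔
      ∀ i, (∃ g : F[X], Irreducible g ∧ g ∣ (f i).comp (X ^ M) ∧
          g.natDegree = (f i).natDegree) ∨
        ∃ b, 1 ≤ b ∧ b ≤ a ∧
          (∃ s : Multiset F[X], Multiset.card s = r ^ (a - b) ∧
            (∀ g ∈ s, g.Monic ∧ Irreducible g ∧ g.natDegree = r ^ b * (f i).natDegree) ∧
            (f i).comp (X ^ M) = s.prod) ∧
          (∀ j, r ^ b ∣ m i j) := by
  subst hMra
  have hM : r ^ a ≠ 0 := (pow_pos hr.pos a).ne'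
  obtain ⟨e⟩ := hiso
  have hfcop : Pairwise fun i j => IsCoprime (f i) (f j) := fun i j hij =>
    (hf i).2.1.coprime_iff_not_dvd.2 fun h => hij <| hinj <|
      eq_of_monic_of_associated (hf i).1 (hf j).1 ((hf i).2.1.associated_of_dvd (hf j).2.1 h)
  constructor
  · rintro ⟨β, hβ⟩ i
    obtain ⟨hfm, hfi, hfX⟩ := hf i
    refine (exists_factor_natDegree_eq_or_exists_multiset hr hfm hfi hfX).imp_right ?_
    rintro ⟨b, hb1, hba, s, hcard, hs, hprod⟩
    refine ⟨b, hb1, hba, ⟨s, hcard, hs, hprod⟩, fun j => ?_⟩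
    have hpow : Matrix.mulVecLin (β : Matrix (Fin n) (Fin n) F) ^ r ^ a =
        Matrix.mulVecLin (α : Matrix (Fin n) (Fin n) F) := by
      rw [← hβ, Units.val_pow_eq_pow_val]
      exact (Matrix.toLin'_pow _ _).symm
    have hdvd : ∀ k, r ^ b * (f i).natDegree ∣ Module.finrank F (kerInfRangePow (Algebra.lsmul F F
        (Module.AEval' (Matrix.mulVecLin (α : Matrix (Fin n) (Fin n) F))) (f i)) k) := by
      intro k
      rw [finrank_kerInfRangePow_aeval'_pow hpow, hprod]
      exact dvd_finrank_kerInfRangePow (fun g hg => (hs g hg).2) k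
    have hj := hdvd j
    rw [finrank_kerInfRangePow_directSum (fun i => (hf i).2.1.ne_zero) hfcop m e i j,
      ← Nat.dvd_add_iff_left (hdvd (j + 1))] at hj
    exact Nat.dvd_of_mul_dvd_mul_right hfi.natDegree_pos hj
  · intro h
    refine exists_pow_eq_of_hasRootOfX hM α (HasRootOfX.of_linearEquiv
      (e.symm.restrictScalars F) (fun x => e.symm.map_smul X x) ?_)
    refine .directSum fun i => .directSum fun j => ?_
    obtain ⟨hfm, hfi, hfX⟩ := hf i
    rcases h i with ⟨g, hg, hgf, hdeg⟩ | ⟨b, -, -, ⟨s, hcard, hs, hprod⟩, hdvd⟩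
    · exact hasRootOfX_pi_of_dvd_comp hcop hfm hfi hfX hg hgf (by rw [hdeg, one_mul])
        (one_dvd _) (j + 1)
    · obtain ⟨g, hg⟩ := Multiset.card_pos_iff_exists_mem.1 (hcard ▸ pow_pos hr.pos (a - b))
      obtain ⟨-, hgi, hdeg⟩ := hs g hg
      exact hasRootOfX_pi_of_dvd_comp hcop hfm hfi hfX hgi (hprod ▸ Multiset.dvd_prod hg) hdeg
        (hdvd j) (j + 1)
end

section
/- Let M be a prime with gcd(q, M) = 1 and let t = 𝔪(M;q) be the multiplicative order of q modulo M. Let α ∈ GL(n, F_q) and suppose F_q^n, viewed as an F_q[X]-module with X acting as α, is isomorphic to ⊕_{i=1}^{l} ⊕_{j ≥ 1} (F_q[X]/(f_i^{j}))^{⊕ m_{ij}}, where f_1,…,f_l are distinct monic irreducible polynomials ≠ X of degrees d_1,…,d_l. Then X^M = α has a solution in GL(n, F_q) if and only if for each i one of the following holds: (1) t does not divide d_i; (2) f_i is an M-power polynomial; or (3) M divides m_{ij} for every j. -/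
open Polynomial DirectSum

/-- If `f(X ^ M)` has an irreducible factor of degree `deg f`, then `X` is an `M`-th power
modulo `f`. -/
theorem exists_dvd_pow_sub_X_of_dvd_comp {F : Type*} [Field F] {M : ℕ} {f g : F[X]}
    (hf : Irreducible f) (hg : Irreducible g) (hgf : g ∣ f.comp (X ^ M))
    (hdeg : g.natDegree = f.natDegree) : ∃ p : F[X], f ∣ p ^ M - X := by
  have := Fact.mk hf
  have := Fact.mk hg
  have hroot : aeval (AdjoinRoot.root g ^ M) f = 0 := by
    have h : aeval (AdjoinRoot.root g) (f.comp (X ^ M)) = 0 := by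
      obtain ⟨c, hc⟩ := hgf
      rw [hc, map_mul, AdjoinRoot.aeval_eq, AdjoinRoot.mk_self, zero_mul]
    simpa [aeval_comp] using h
  let φ : AdjoinRoot f →ₐ[F] AdjoinRoot g :=
    AdjoinRoot.liftAlgHom f (Algebra.ofId F _) (AdjoinRoot.root g ^ M) hroot
  have hφ : φ (AdjoinRoot.root f) = AdjoinRoot.root g ^ M :=
    AdjoinRoot.liftAlgHom_root ..
  have hinj : Function.Injective φ := φ.toRingHom.injective
  have : FiniteDimensional F (AdjoinRoot f) := (AdjoinRoot.powerBasis hf.ne_zero).finite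
  have : FiniteDimensional F (AdjoinRoot g) := (AdjoinRoot.powerBasis hg.ne_zero).finite
  have hfin : Module.finrank F (AdjoinRoot f) = Module.finrank F (AdjoinRoot g) := by
    rw [(AdjoinRoot.powerBasis hf.ne_zero).finrank, (AdjoinRoot.powerBasis hg.ne_zero).finrank,
      AdjoinRoot.powerBasis_dim, AdjoinRoot.powerBasis_dim, hdeg]
  have hsurj : Function.Surjective φ :=
    (LinearMap.injective_iff_surjective_of_finrank_eq_finrank (f := φ.toLinearMap) hfin).1 hinj
  obtain ⟨y, hy⟩ := hsurj (AdjoinRoot.root g)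
  obtain ⟨p, rfl⟩ := AdjoinRoot.mk_surjective y
  refine ⟨p, AdjoinRoot.mk_eq_zero.1 <| hinj ?_⟩
  rw [map_sub, map_pow, AdjoinRoot.mk_X, map_sub, map_pow, hy, hφ, sub_self, map_zero]

theorem exists_irreducible_dvd_comp_of_dvd_pow_sub_X {F : Type*} [Field F] {M : ℕ} {f p : F[X]}
    (hf : Irreducible f) (hp : f ∣ p ^ M - X) :
    ∃ g : F[X], Irreducible g ∧ g ∣ f.comp (X ^ M) ∧ g.natDegree = f.natDegree := by
  have := Fact.mk hf
  have : FiniteDimensional F (AdjoinRoot f) := (AdjoinRoot.powerBasis hf.ne_zero).finite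
  set μ := AdjoinRoot.mk f p
  have hμ : μ ^ M = AdjoinRoot.root f := by
    rw [← sub_eq_zero, ← AdjoinRoot.mk_X, ← map_pow, ← map_sub, AdjoinRoot.mk_eq_zero]
    exact hp
  have hint : IsIntegral F μ := Algebra.IsIntegral.isIntegral μ
  refine ⟨minpoly F μ, minpoly.irreducible hint, minpoly.dvd F μ ?_, ?_⟩
  · simp [aeval_comp, hμ]
  · have htop : IntermediateField.adjoin F {μ} = ⊤ := by
      rw [eq_top_iff]
      intro y _
      obtain ⟨r, rfl⟩ := AdjoinRoot.mk_surjective y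
      rw [← AdjoinRoot.aeval_eq, ← hμ]
      exact Algebra.adjoin_singleton_le
        (pow_mem (IntermediateField.mem_adjoin_simple_self F μ) M :
          μ ^ M ∈ (IntermediateField.adjoin F {μ}).toSubalgebra)
        (aeval_mem_adjoin_singleton F (μ ^ M))
    rw [← IntermediateField.adjoin.finrank hint, htop, IntermediateField.finrank_top',
      (AdjoinRoot.powerBasis hf.ne_zero).finrank, AdjoinRoot.powerBasis_dim]

theorem not_dvd_X_of_ne {F : Type*} [Field F] {f : F[X]} (hm : f.Monic) (hf : Irreducible f)
    (hX : f ≠ X) : ¬ f ∣ X := fun h =>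
  hX <| eq_of_monic_of_associated hm monic_X (hf.associated_of_dvd irreducible_X h)

theorem exists_dvd_pow_sub_X_of_not_dvd {F : Type*} [Field F] [Fintype F] {M : ℕ} (hM : M.Prime)
    {f : F[X]} (hm : f.Monic) (hf : Irreducible f) (hX : f ≠ X)
    (ht : ¬ orderOf ((Fintype.card F : ZMod M)) ∣ f.natDegree) : ∃ p : F[X], f ∣ p ^ M - X := by
  have := Fact.mk hf
  have : FiniteDimensional F (AdjoinRoot f) := (AdjoinRoot.powerBasis hf.ne_zero).finite
  have : Finite (AdjoinRoot f) := Module.finite_of_finite F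
  have hcard : Nat.card (AdjoinRoot f) = Fintype.card F ^ f.natDegree := by
    rw [Module.natCard_eq_pow_finrank (K := F), (AdjoinRoot.powerBasis hf.ne_zero).finrank,
      AdjoinRoot.powerBasis_dim, Nat.card_eq_fintype_card]
  have hcop : (Nat.card (AdjoinRoot f)ˣ).Coprime M := by
    rw [Nat.coprime_comm, hM.coprime_iff_not_dvd, Nat.card_units, hcard]
    intro h
    apply ht
    rw [orderOf_dvd_iff_pow_eq_one]
    have h1 : 1 ≤ Fintype.card F ^ f.natDegree := Nat.one_le_pow _ _ Fintype.card_pos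
    have h2 := (ZMod.natCast_eq_zero_iff _ _).2 h
    rw [Nat.cast_sub h1, sub_eq_zero] at h2
    exact_mod_cast h2
  have hne : AdjoinRoot.root f ≠ 0 := by
    rw [← AdjoinRoot.mk_X, Ne, AdjoinRoot.mk_eq_zero]
    exact not_dvd_X_of_ne hm hf hX
  obtain ⟨u, hu⟩ := (powCoprime hcop).surjective (Units.mk0 _ hne)
  obtain ⟨p, hp⟩ := AdjoinRoot.mk_surjective (u : AdjoinRoot f)
  refine ⟨p, AdjoinRoot.mk_eq_zero.1 ?_⟩
  have hu' := congrArg Units.val hu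
  simp only [powCoprime_apply, Units.val_pow_eq_pow_val, Units.val_mk0] at hu'
  rw [map_sub, map_pow, hp, AdjoinRoot.mk_X, hu', sub_self]

/-- An `M`-th root of `X` modulo `f` lifts to one modulo any power of `f`. -/
theorem exists_pow_dvd_pow_sub_X {F : Type*} [Field F] {M : ℕ} (hM : (M : F) ≠ 0)
    {f p : F[X]} (hf : Irreducible f) (hX : ¬ f ∣ X) (hp : f ∣ p ^ M - X) (k : ℕ) :
    ∃ r : F[X], f ^ k ∣ r ^ M - X := by
  have hpf : IsCoprime (f ^ k) p := by
    refine IsCoprime.pow_left ((hf.coprime_iff_not_dvd).2 fun h => hX ?_)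
    have hM0 : M ≠ 0 := by rintro rfl; simp at hM
    exact (dvd_sub_right (h.trans (dvd_pow_self p hM0))).1 hp
  let P : (AdjoinRoot (f ^ k))[X] := X ^ M - C (AdjoinRoot.root (f ^ k))
  have h1 : IsNilpotent (aeval (AdjoinRoot.mk (f ^ k) p) P) := by
    refine ⟨k, ?_⟩
    simp only [P, map_sub, map_pow, aeval_X, aeval_C, Algebra.algebraMap_self, RingHom.id_apply]
    rw [← AdjoinRoot.mk_X, ← map_pow, ← map_sub, ← map_pow, AdjoinRoot.mk_eq_zero]
    exact pow_dvd_pow_of_dvd hp k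
  have hMu : IsUnit (M : AdjoinRoot (f ^ k)) := by
    simpa using (IsUnit.mk0 _ hM).map (algebraMap F (AdjoinRoot (f ^ k)))
  have hpu : IsUnit (AdjoinRoot.mk (f ^ k) p) := by
    obtain ⟨a, b, hab⟩ := hpf
    refine IsUnit.of_mul_eq_one (AdjoinRoot.mk (f ^ k) b) ?_
    have := congrArg (AdjoinRoot.mk (f ^ k)) hab
    simpa [mul_comm, AdjoinRoot.mk_self, -map_pow] using this
  have h2 : IsUnit (aeval (AdjoinRoot.mk (f ^ k) p) (derivative P)) := by
    simp only [P, derivative_sub, derivative_X_pow, derivative_C, sub_zero, map_mul, map_pow,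
      aeval_X, map_natCast]
    exact hMu.mul (hpu.pow _)
  obtain ⟨r, ⟨-, hr⟩, -⟩ := existsUnique_nilpotent_sub_and_aeval_eq_zero h1 h2
  obtain ⟨r, rfl⟩ := AdjoinRoot.mk_surjective r
  refine ⟨r, AdjoinRoot.mk_eq_zero.1 ?_⟩
  simpa [P] using hr

/-- Block-diagonal sum of companion matrices of `X ^ M - x`. -/
theorem Matrix.exists_pow_eq_algebraMap {A : Type*} [CommRing A] [Nontrivial A] (x : A) {M m : ℕ}
    (hM : M ≠ 0) (hm : M ∣ m) : ∃ P : Matrix (Fin m) (Fin m) A, P ^ M = algebraMap A _ x := by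
  obtain ⟨k, rfl⟩ := hm
  have hmon : (X ^ M - C x).Monic := monic_X_pow_sub_C x hM
  let pb := AdjoinRoot.powerBasis' hmon
  have hdim : pb.dim = M := by simp [pb]
  have e : Fin pb.dim × Fin k ≃ Fin (M * k) :=
    finProdFinEquiv.trans (finCongr (by rw [hdim]))
  let P := Algebra.leftMulMatrix pb.basis (AdjoinRoot.root (X ^ M - C x))
  have hP : P ^ M = algebraMap A _ x := by
    rw [← map_pow, ← AlgHom.commutes (Algebra.leftMulMatrix pb.basis)]
    congr 1
    have h : AdjoinRoot.mk (X ^ M - C x) (X ^ M - C x) = 0 := AdjoinRoot.mk_self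
    rw [map_sub, map_pow, AdjoinRoot.mk_X, AdjoinRoot.mk_C, sub_eq_zero] at h
    exact h
  refine ⟨Matrix.reindexAlgEquiv A A e (Matrix.blockDiagonal fun _ => P), ?_⟩
  rw [← map_pow, ← Matrix.blockDiagonal_pow]
  have h : (fun _ : Fin k => P) ^ M = algebraMap A _ x := by
    ext1; simp [hP]
  rw [h, ← AlgEquiv.commutes (Matrix.reindexAlgEquiv A A e)]
  congr 1
  ext ⟨a, b⟩ ⟨c, d⟩
  simp [Matrix.blockDiagonal_apply, Matrix.algebraMap_matrix_apply, Prod.ext_iff]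
  grind

theorem DirectSum.exists_end_pow_eq_algebraMap {A ι : Type*} [CommRing A] {V : ι → Type*}
    [∀ i, AddCommGroup (V i)] [∀ i, Module A (V i)] (x : A) (M : ℕ)
    (h : ∀ i, ∃ B : Module.End A (V i), B ^ M = algebraMap A _ x) :
    ∃ B : Module.End A (⨁ i, V i), B ^ M = algebraMap A _ x := by
  choose B hB using h
  refine ⟨DirectSum.lmap B, ?_⟩
  have key : ∀ k : ℕ, (DirectSum.lmap B) ^ k = DirectSum.lmap fun i => B i ^ k := by
    intro k
    induction k with
    | zero => simp [Module.End.one_eq_id]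
    | succ k ih => simp only [pow_succ, ih, Module.End.mul_eq_comp, DirectSum.lmap_comp]
  rw [key]
  refine LinearMap.ext fun v => DFinsupp.ext fun i => ?_
  rw [DirectSum.lmap_apply, hB, Module.algebraMap_end_apply, Module.algebraMap_end_apply]
  rfl

/-- Roots of `X` in the endomorphism ring of the `F[X]`-module of `a` are roots of `a`. -/
theorem Module.AEval'.exists_end_pow_eq_algebraMap_iff {F V : Type*} [Field F] [AddCommGroup V]
    [Module F V] (a : V →ₗ[F] V) (M : ℕ) :
    (∃ B : Module.End F[X] (Module.AEval' a), B ^ M = algebraMap F[X] _ X) ↔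
      ∃ b : Module.End F V, b ^ M = a := by
  constructor
  · rintro ⟨B, hB⟩
    let b : Module.End F V := (Module.AEval'.of a).symm.conj (B.restrictScalars F)
    have hb : ∀ (k : ℕ) v, Module.AEval'.of a ((b ^ k) v) = (B ^ k) (Module.AEval'.of a v) := by
      intro k
      induction k with
      | zero => simp
      | succ k ih =>
        intro v
        rw [pow_succ, pow_succ, Module.End.mul_apply, ih, Module.End.mul_apply]
        simp [b, LinearEquiv.conj_apply]
    refine ⟨b, LinearMap.ext fun v => (Module.AEval'.of a).injective ?_⟩
    rw [hb, hB, Module.algebraMap_end_apply, Module.AEval'.X_smul_of]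
  · rintro ⟨b, hb⟩
    have hcomm : ∀ v, b (a v) = a (b v) := by
      intro v
      rw [← hb, ← Module.End.mul_apply, ← Module.End.mul_apply, ← pow_succ, ← pow_succ']
    let B : Module.End F[X] (Module.AEval' a) :=
      LinearMap.ofAEval a ((Module.AEval'.of a).toLinearMap ∘ₗ b) fun v => by
        simp [Module.AEval'.X_smul_of, hcomm]
    have hB : ∀ (k : ℕ) v, (B ^ k) (Module.AEval'.of a v) = Module.AEval'.of a ((b ^ k) v) := by
      intro k
      induction k with
      | zero => simp
      | succ k ih =>
        intro v
        rw [pow_succ, pow_succ, Module.End.mul_apply, Module.End.mul_apply, ← ih]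
        rfl
    refine ⟨B, LinearMap.ext fun v => ?_⟩
    obtain ⟨v, rfl⟩ := (Module.AEval'.of a).surjective v
    rw [hB, hb, Module.algebraMap_end_apply, Module.AEval'.X_smul_of]

/-- An endomorphism descends to any subquotient it preserves, together with its power relation. -/
theorem Module.End.exists_pow_eq_algebraMap_of_subquotient {A D N : Type*} [CommRing A]
    [AddCommGroup D] [Module A D] [AddCommGroup N] [Module A N] {x : A} {M : ℕ}
    {B : Module.End A D} (hB : B ^ M = algebraMap A _ x) (S : Submodule A D)
    (hS : ∀ w ∈ S, B w ∈ S) (ψ : D →ₗ[A] N) (hψ : ∀ v, ∃ w ∈ S, ψ w = v)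
    (hker : ∀ w ∈ S, ψ w = 0 → ψ (B w) = 0) :
    ∃ C : Module.End A N, C ^ M = algebraMap A _ x := by
  choose s hsS hs using hψ
  have key : ∀ w ∈ S, ∀ w' ∈ S, ψ w = ψ w' → ψ (B w) = ψ (B w') := by
    intro w hw w' hw' h
    rw [← sub_eq_zero, ← map_sub, ← map_sub]
    exact hker _ (S.sub_mem hw hw') (by rw [map_sub, h, sub_self])
  let C : Module.End A N :=
    { toFun := fun v => ψ (B (s v))
      map_add' := fun u v => by
        rw [key _ (hsS _) (s u + s v) (S.add_mem (hsS _) (hsS _)) (by simp [hs])]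
        simp
      map_smul' := fun a v => by
        rw [key _ (hsS _) (a • s v) (S.smul_mem _ (hsS _)) (by simp [hs])]
        simp }
  have hC : ∀ w ∈ S, C (ψ w) = ψ (B w) := fun w hw => key _ (hsS _) w hw (hs _)
  have hpow : ∀ k : ℕ, ∀ w ∈ S, (C ^ k) (ψ w) = ψ ((B ^ k) w) := by
    intro k
    induction k with
    | zero => simp
    | succ k ih =>
      intro w hw
      rw [pow_succ, pow_succ, Module.End.mul_apply, Module.End.mul_apply, hC w hw,
        ih _ (hS w hw)]
  refine ⟨C, LinearMap.ext fun v => ?_⟩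
  rw [← hs v, hpow M _ (hsS v), hB]
  simp

/-- If `M` does not divide `m`, comparing determinants turns an `M`-th root of `X` on
`(F[X]/f)^m` into one in `F[X]/f`. -/
theorem exists_dvd_pow_sub_X_of_end {F : Type*} [Field F] {M m : ℕ} (hM : M.Prime) {f : F[X]}
    (hf : Irreducible f) (hX : ¬ f ∣ X) (hm : ¬ M ∣ m)
    {C : Module.End F[X] (Fin m → F[X] ⧸ Ideal.span {f})} (hC : C ^ M = algebraMap F[X] _ X) :
    ∃ p : F[X], f ∣ p ^ M - X := by
  let C' : Module.End (F[X] ⧸ Ideal.span {f}) (Fin m → F[X] ⧸ Ideal.span {f}) :=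
    C.extendScalarsOfSurjective Ideal.Quotient.mk_surjective
  set x := Ideal.Quotient.mk (Ideal.span {f}) X with hx
  have hC' : C' ^ M = x • 1 := by
    have hk : ∀ (k : ℕ) v, (C' ^ k) v = (C ^ k) v := by
      intro k
      induction k with
      | zero => simp
      | succ k ih =>
        intro v
        rw [pow_succ, pow_succ, Module.End.mul_apply, Module.End.mul_apply, ih]
        rfl
    refine LinearMap.ext fun v => ?_
    rw [hk, hC]
    rfl
  have hdet : LinearMap.det C' ^ M = x ^ m := by
    rw [← map_pow, hC', ← LinearMap.det_toMatrix']
    simp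
  obtain ⟨s, r, hsr⟩ := (hf.coprime_iff_not_dvd).2 hX
  have hy : Ideal.Quotient.mk (Ideal.span {f}) r * x = 1 := by
    rw [hx, ← map_mul, ← map_one (Ideal.Quotient.mk _), Ideal.Quotient.eq,
      Ideal.mem_span_singleton, ← hsr]
    exact ⟨-s, by ring⟩
  obtain ⟨a, -, ha⟩ := Nat.exists_mul_mod_eq_one_of_coprime
    ((hM.coprime_iff_not_dvd.2 hm).symm) hM.one_lt
  obtain ⟨b, hb⟩ : ∃ b, m * a = M * b + 1 := ⟨m * a / M, by rw [← ha, Nat.div_add_mod]⟩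
  obtain ⟨p, hp⟩ := Ideal.Quotient.mk_surjective
    (LinearMap.det C' ^ a * Ideal.Quotient.mk (Ideal.span {f}) r ^ b)
  refine ⟨p, ?_⟩
  rw [← Ideal.mem_span_singleton, ← Ideal.Quotient.eq, map_pow, hp, mul_pow, ← pow_mul,
    mul_comm a M, pow_mul, hdet, ← pow_mul, hb, pow_succ, ← pow_mul, mul_comm b M,
    mul_right_comm, ← mul_pow, mul_comm x, hy, one_pow, one_mul]

theorem exists_eq_smul_of_pow_smul_eq_zero {A : Type*} [CommRing A] [IsDomain A] {f : A}
    (hf : f ≠ 0) {m a k : ℕ} (hak : a < k) (v : Fin m → A ⧸ Ideal.span {f ^ k})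
    (hv : f ^ a • v = 0) : ∃ u, v = f • u := by
  have h : ∀ s, ∃ u, v s = f • u := by
    intro s
    obtain ⟨p, hp⟩ := Ideal.Quotient.mk_surjective (v s)
    have hs : f ^ a • v s = 0 := congrFun hv s
    rw [← hp, ← Ideal.Quotient.mk_eq_mk, ← Submodule.Quotient.mk_smul,
      Submodule.Quotient.mk_eq_zero, Ideal.mem_span_singleton, smul_eq_mul,
      ← Nat.sub_add_cancel hak.le, pow_add, mul_comm,
      mul_dvd_mul_iff_left (pow_ne_zero _ hf)] at hs
    obtain ⟨c, rfl⟩ := (dvd_pow_self f (Nat.sub_ne_zero_of_lt hak)).trans hs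
    exact ⟨Ideal.Quotient.mk _ c, by rw [← hp, map_mul]; rfl⟩
  choose u hu using h
  exact ⟨u, funext hu⟩

theorem DirectSum.mem_of_forall_lof_mem {A ι : Type*} [DecidableEq ι] [CommRing A]
    {V : ι → Type*} [∀ i, AddCommGroup (V i)] [∀ i, Module A (V i)]
    (S : Submodule A (⨁ i, V i)) (x : ⨁ i, V i)
    (h : ∀ i, DirectSum.lof A ι V i (x i) ∈ S) : x ∈ S := by
  classical
  rw [← DirectSum.sum_support_of x]
  exact S.sum_mem fun i _ => h i

/-- Reduction modulo `f`. -/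
noncomputable def quotientPowReduction {A : Type*} [CommRing A] (f : A) (m k : ℕ) :
    (Fin m → A ⧸ Ideal.span {f ^ (k + 1)}) →ₗ[A] (Fin m → A ⧸ Ideal.span {f}) :=
  LinearMap.compLeft (Submodule.factor (Ideal.span_singleton_le_span_singleton.2
    (dvd_pow_self f k.succ_ne_zero))) (Fin m)

theorem quotientPowReduction_surjective {A : Type*} [CommRing A] (f : A) (m k : ℕ) :
    Function.Surjective (quotientPowReduction f m k) := by
  intro v
  choose w hw using fun s => Submodule.factor_surjective
    (Ideal.span_singleton_le_span_singleton.2 (dvd_pow_self f k.succ_ne_zero)) (v s)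
  exact ⟨w, funext hw⟩

theorem smul_quotient_span_eq_zero {A : Type*} [CommRing A] (h : A) {m : ℕ}
    (v : Fin m → A ⧸ Ideal.span {h}) : h • v = 0 := by
  funext s
  obtain ⟨p, hp⟩ := Ideal.Quotient.mk_surjective (v s)
  rw [Pi.smul_apply, ← hp, ← Ideal.Quotient.mk_eq_mk, ← Submodule.Quotient.mk_smul]
  exact (Submodule.Quotient.mk_eq_zero _).2 (Ideal.mem_span_singleton.2 (dvd_mul_right h p))

theorem exists_eq_smul_of_quotientPowReduction_eq_zero {A : Type*} [CommRing A] (f : A) (m k : ℕ)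
    (v : Fin m → A ⧸ Ideal.span {f ^ (k + 1)}) (hv : quotientPowReduction f m k v = 0) :
    ∃ u, v = f • u := by
  have h : ∀ s, ∃ u, v s = f • u := by
    intro s
    obtain ⟨p, hp⟩ := Ideal.Quotient.mk_surjective (v s)
    have hs : Submodule.factor (Ideal.span_singleton_le_span_singleton.2
      (dvd_pow_self f k.succ_ne_zero)) (v s) = 0 := congrFun hv s
    rw [← hp] at hs
    obtain ⟨c, rfl⟩ := Ideal.mem_span_singleton.1 ((Submodule.Quotient.mk_eq_zero _).1 hs)
    exact ⟨Ideal.Quotient.mk _ c, by rw [← hp, map_mul]; rfl⟩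
  choose u hu using h
  exact ⟨u, funext hu⟩

/-- An `M`-th root of multiplication by `x` on `⨁ i j, (A/(f i)^(j+1))^(m i j)` induces one on
each `(A/f i)^(m i j)`. -/
theorem exists_end_quotient_of_end_directSum {A ι : Type*} [CommRing A] [IsDomain A]
    {f : ι → A} (hf0 : ∀ i, f i ≠ 0) (hcop : ∀ i i', i ≠ i' → IsCoprime (f i) (f i'))
    (m : ι → ℕ → ℕ) {x : A} {M : ℕ}
    {B : Module.End A (⨁ i : ι, ⨁ j : ℕ, (Fin (m i j) → A ⧸ Ideal.span {f i ^ (j + 1)}))}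
    (hB : B ^ M = algebraMap A _ x) (i₀ : ι) (j₀ : ℕ) :
    ∃ C : Module.End A (Fin (m i₀ j₀) → A ⧸ Ideal.span {f i₀}), C ^ M = algebraMap A _ x := by
  classical
  let V : ι → ℕ → Type _ := fun i j => Fin (m i j) → A ⧸ Ideal.span {f i ^ (j + 1)}
  let D := ⨁ i : ι, ⨁ j : ℕ, V i j
  let emb (i j) : V i j →ₗ[A] D :=
    DirectSum.lof A ι (fun i => ⨁ j, V i j) i ∘ₗ DirectSum.lof A ℕ (V i) j
  let proj : D →ₗ[A] V i₀ j₀ :=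
    DirectSum.component A ℕ (V i₀) j₀ ∘ₗ DirectSum.component A ι (fun i => ⨁ j, V i j) i₀
  let ψ := quotientPowReduction (f i₀) (m i₀ j₀) j₀ ∘ₗ proj
  let T (k : ℕ) : Submodule A D := Submodule.torsionBy A D (f i₀ ^ k)
  have hT {k w} : w ∈ T k ↔ f i₀ ^ k • w = 0 := Submodule.mem_torsionBy_iff _ _
  have hBT {k w} (hw : w ∈ T k) : B w ∈ T k := by
    rw [hT] at hw ⊢
    rw [← map_smul, hw, map_zero]
  let K : Submodule A D := T j₀ ⊔ (T (j₀ + 2)).map (LinearMap.lsmul A D (f i₀))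
  have hsmul (w : D) : ψ (f i₀ • w) = 0 := by
    rw [map_smul]
    exact smul_quotient_span_eq_zero (f i₀) _
  have hKψ : ∀ w ∈ K, ψ (B w) = 0 := by
    intro w hw
    obtain ⟨a, ha, b, hb, rfl⟩ := Submodule.mem_sup.1 hw
    obtain ⟨c, hc, rfl⟩ := Submodule.mem_map.1 hb
    rw [LinearMap.lsmul_apply, map_add, map_smul, map_add, hsmul, add_zero]
    obtain ⟨u, hu⟩ := exists_eq_smul_of_pow_smul_eq_zero (hf0 i₀) (Nat.lt_succ_self j₀)
      (proj (B a)) (by rw [← map_smul, hT.1 (hBT ha), map_zero])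
    rw [LinearMap.comp_apply, hu, map_smul]
    exact smul_quotient_span_eq_zero (f i₀) _
  -- an element of `f • V` killed by `f ^ (j₀ + 1)` lies in `K`
  have hfK (i j) (v : V i j) (hv : f i₀ ^ (j₀ + 1) • v = 0) (h : ∃ u, v = f i₀ • u) :
      emb i j v ∈ K := by
    obtain ⟨u, rfl⟩ := h
    refine Submodule.mem_sup_right (Submodule.mem_map.2 ⟨emb i j u, hT.2 ?_, ?_⟩)
    · have hu : f i₀ ^ (j₀ + 2) • u = 0 := by rw [pow_succ _ (j₀ + 1), mul_smul, hv]
      exact (map_smul (emb i j) _ u).symm.trans ((congrArg _ hu).trans (map_zero _))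
    · rw [LinearMap.lsmul_apply, map_smul]
  have hSK : ∀ w ∈ T (j₀ + 1), ψ w = 0 → w ∈ K := by
    intro w hw hψw
    have hw' (i j) : f i₀ ^ (j₀ + 1) • w i j = 0 :=
      DFunLike.congr_fun (DFunLike.congr_fun (hT.1 hw) i) j
    refine DirectSum.mem_of_forall_lof_mem K w fun i => ?_
    refine DirectSum.mem_of_forall_lof_mem
      (K.comap (DirectSum.lof A ι (fun i => ⨁ j, V i j) i)) (w i) fun j => ?_
    change emb i j (w i j) ∈ K
    rcases eq_or_ne i i₀ with rfl | hi
    · rcases lt_trichotomy j j₀ with hj | rfl | hj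
      · refine Submodule.mem_sup_left (hT.2 ?_)
        obtain ⟨c, hc⟩ := Nat.exists_eq_add_of_lt hj
        have h0 : f i ^ j₀ • w i j = 0 := by
          rw [hc, add_right_comm, pow_add _ (j + 1) c, mul_comm, mul_smul]
          exact (congrArg _ (smul_quotient_span_eq_zero _ _)).trans (smul_zero _)
        exact (map_smul (emb i j) _ (w i j)).symm.trans ((congrArg _ h0).trans (map_zero _))
      · exact hfK _ _ _ (hw' _ _) (exists_eq_smul_of_quotientPowReduction_eq_zero _ _ _ _ hψw)
      · exact hfK _ _ _ (hw' _ _)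
          (exists_eq_smul_of_pow_smul_eq_zero (hf0 _) (Nat.succ_lt_succ hj) _ (hw' _ _))
    · obtain ⟨a, b, hab⟩ := (hcop i i₀ hi).pow (m := j + 1) (n := j₀ + 1)
      have h0 : w i j = 0 := by
        rw [← one_smul A (w i j), ← hab, add_smul, mul_smul, mul_smul, hw',
          smul_quotient_span_eq_zero, smul_zero, smul_zero, add_zero]
      rw [h0, map_zero]
      exact K.zero_mem
  refine Module.End.exists_pow_eq_algebraMap_of_subquotient hB (T (j₀ + 1)) (fun w => hBT) ψ
    (fun v => ?_) fun w hw h => hKψ w (hSK w hw h)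
  obtain ⟨u, rfl⟩ := quotientPowReduction_surjective (f i₀) (m i₀ j₀) j₀ v
  refine ⟨emb i₀ j₀ u, hT.2 ?_, ?_⟩
  · exact (map_smul (emb i₀ j₀) _ u).symm.trans
      ((congrArg _ (smul_quotient_span_eq_zero _ u)).trans (map_zero _))
  · refine congrArg (quotientPowReduction (f i₀) (m i₀ j₀) j₀) ?_
    exact (congrArg (DirectSum.component A ℕ (V i₀) j₀)
      (DirectSum.lof_apply A (M := fun i => ⨁ j, V i j) i₀ _)).trans
        (DirectSum.lof_apply A (M := V i₀) j₀ u)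

/-- `X ^ M = α` is solvable in `GL` if and only if it is solvable among endomorphisms. -/
theorem Matrix.GeneralLinearGroup.exists_pow_eq_iff {F ι : Type*} [Field F] [Fintype ι]
    [DecidableEq ι] {M : ℕ} (hM : M ≠ 0) {α : GL ι F} :
    (∃ β : GL ι F, β ^ M = α) ↔
      ∃ b : Module.End F (ι → F), b ^ M = Matrix.mulVecLin (α : Matrix ι ι F) := by
  constructor
  · rintro ⟨β, rfl⟩
    exact ⟨Matrix.toLinAlgEquiv' (β : Matrix ι ι F),
      (map_pow Matrix.toLinAlgEquiv' (β : Matrix ι ι F) M).symm⟩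
  · rintro ⟨b, hb⟩
    have h : LinearMap.toMatrixAlgEquiv' b ^ M = (α : Matrix ι ι F) := by
      rw [← map_pow, hb]
      exact LinearMap.toMatrixAlgEquiv'_toLinAlgEquiv' _
    have hu : IsUnit (LinearMap.toMatrixAlgEquiv' b) :=
      (isUnit_pow_iff hM).1 (h ▸ α.isUnit)
    exact ⟨hu.unit, Units.ext h⟩

theorem LinearEquiv.exists_end_pow_eq_algebraMap_iff {A V W : Type*} [CommSemiring A]
    [AddCommMonoid V] [Module A V] [AddCommMonoid W] [Module A W] (e : V ≃ₗ[A] W) {x : A} {M : ℕ} :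
    (∃ B : Module.End A V, B ^ M = algebraMap A _ x) ↔
      ∃ B : Module.End A W, B ^ M = algebraMap A _ x := by
  constructor
  · rintro ⟨B, hB⟩
    exact ⟨e.conjAlgEquiv A B, by rw [← map_pow, hB, AlgEquiv.commutes]⟩
  · rintro ⟨B, hB⟩
    exact ⟨e.symm.conjAlgEquiv A B, by rw [← map_pow, hB, AlgEquiv.commutes]⟩

theorem exists_end_pi_pow_eq_algebraMap {A R : Type*} [CommRing A] [CommRing R] [Nontrivial R]
    [Algebra A R] (x : A) {M m : ℕ} (hM : M ≠ 0) (hm : M ∣ m) :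
    ∃ B : Module.End A (Fin m → R), B ^ M = algebraMap A _ x := by
  obtain ⟨P, hP⟩ := Matrix.exists_pow_eq_algebraMap (algebraMap A R x) hM hm
  refine ⟨(Matrix.toLinAlgEquiv' P).restrictScalars A, ?_⟩
  have hpow (k : ℕ) (v : Fin m → R) :
      (((Matrix.toLinAlgEquiv' P).restrictScalars A) ^ k) v = Matrix.toLinAlgEquiv' (P ^ k) v := by
    induction k generalizing v with
    | zero => simp
    | succ k ih => simp [pow_succ, ih]
  refine LinearMap.ext fun v => ?_
  rw [hpow, hP, AlgEquiv.commutes, Module.algebraMap_end_apply, Module.algebraMap_end_apply,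
    algebraMap_smul]

/-- Let `M` be a prime with `gcd(q,M) = 1` and `t = 𝔪(M;q)` the
multiplicative order of `q` mod `M`.  Let `α ∈ GL(n, F_q)` with `F_q^n`, as an
`F_q[X]`-module via `α`, isomorphic to `⊕_i ⊕_{j ≥ 1} (F_q[X]/(f_i^j))^{⊕ m_{ij}}`
(here `m i j` is the multiplicity of exponent `j+1`), where the `f_i` are distinct monic
irreducible polynomials `≠ X` of degrees `d_i`.  Then `X^M = α` has a solution in
`GL(n, F_q)` iff for each `i`: `t ∤ d_i`, or `f_i` is an M-power polynomial, or `M` divides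
every multiplicity `m_{ij}`. -/
theorem statement9 (F : Type*) [Field F] [Fintype F] (M : ℕ) (hM : M.Prime)
    (hcop : Nat.Coprime (Fintype.card F) M)
    (t : ℕ) (ht : t = orderOf ((Fintype.card F : ZMod M)))
    (n : ℕ) (α : GL (Fin n) F)
    (l : ℕ) (hl : 0 < l) (f : Fin l → F[X]) (hinj : Function.Injective f)
    (hf : ∀ i, (f i).Monic ∧ Irreducible (f i) ∧ f i ≠ X)
    (d : Fin l → ℕ) (hd : ∀ i, (f i).natDegree = d i)
    (m : Fin l → ℕ → ℕ) (hm : ∀ i, ∃ j, 0 < m i j)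
    (hiso : Nonempty ((Module.AEval' (Matrix.mulVecLin (α : Matrix (Fin n) (Fin n) F)))
      ≃ₗ[F[X]] ⨁ i : Fin l, ⨁ j : ℕ, (Fin (m i j) → F[X] ⧸ Ideal.span {f i ^ (j + 1)}))) :
    (∃ β : GL (Fin n) F, β ^ M = α) ↔
      ∀ i, (¬ t ∣ d i) ∨
        (∃ g : F[X], Irreducible g ∧ g ∣ (f i).comp (X ^ M) ∧
          g.natDegree = (f i).natDegree) ∨
        (∀ j, M ∣ m i j) := by
  have hMF : (M : F) ≠ 0 := by
    intro h
    have hp := CharP.char_is_prime F (ringChar F)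
    have h1 : ringChar F ∣ M := (ringChar.spec F M).1 h
    have h2 : ringChar F ∣ Fintype.card F :=
      (ringChar.spec F _).1 (FiniteField.cast_card_eq_zero F)
    exact hp.ne_one (Nat.dvd_one.1 (hcop ▸ Nat.dvd_gcd h2 h1))
  have hX i : ¬ f i ∣ X := not_dvd_X_of_ne (hf i).1 (hf i).2.1 (hf i).2.2
  obtain ⟨e⟩ := hiso
  rw [Matrix.GeneralLinearGroup.exists_pow_eq_iff hM.ne_zero,
    ← Module.AEval'.exists_end_pow_eq_algebraMap_iff,
    e.exists_end_pow_eq_algebraMap_iff]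
  constructor
  · rintro ⟨B, hB⟩ i
    refine or_iff_not_imp_left.2 fun _ => or_iff_not_imp_right.2 fun h => ?_
    push Not at h
    obtain ⟨j, hj⟩ := h
    obtain ⟨C, hC⟩ := exists_end_quotient_of_end_directSum (fun i => (hf i).2.1.ne_zero)
      (fun i i' hii => ((hf i).2.1.coprime_iff_not_dvd).2 fun hdvd => hii <| hinj <|
        eq_of_monic_of_associated (hf i).1 (hf i').1
          ((hf i).2.1.associated_of_dvd (hf i').2.1 hdvd)) m hB i j
    obtain ⟨p, hp⟩ := exists_dvd_pow_sub_X_of_end hM (hf i).2.1 (hX i) hj hC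
    exact exists_irreducible_dvd_comp_of_dvd_pow_sub_X (hf i).2.1 hp
  · intro h
    refine DirectSum.exists_end_pow_eq_algebraMap _ _ fun i =>
      DirectSum.exists_end_pow_eq_algebraMap _ _ fun j => ?_
    have hcases : (∃ p : F[X], f i ∣ p ^ M - X) ∨ ∀ j, M ∣ m i j := by
      rcases h i with h | ⟨g, hg, hgf, hdeg⟩ | h
      · refine Or.inl (exists_dvd_pow_sub_X_of_not_dvd hM (hf i).1 (hf i).2.1 (hf i).2.2 ?_)
        rwa [← ht, hd]
      · exact Or.inl (exists_dvd_pow_sub_X_of_dvd_comp (hf i).2.1 hg hgf hdeg)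
      · exact Or.inr h
    rcases hcases with ⟨p, hp⟩ | h
    · obtain ⟨r, hr⟩ := exists_pow_dvd_pow_sub_X hMF (hf i).2.1 (hX i) hp (j + 1)
      refine ⟨algebraMap F[X] _ r, ?_⟩
      rw [← map_pow, ← sub_eq_zero, ← map_sub]
      obtain ⟨c, hc⟩ := hr
      refine LinearMap.ext fun v => ?_
      rw [Module.algebraMap_end_apply, hc, mul_smul, smul_quotient_span_eq_zero]
      rfl
    · have : Nontrivial (F[X] ⧸ Ideal.span {f i ^ (j + 1)}) := by
        rw [Ideal.Quotient.nontrivial_iff, Ne, Ideal.span_singleton_eq_top]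
        exact fun hu => (hf i).2.1.not_isUnit (isUnit_of_dvd_unit (dvd_pow_self _ j.succ_ne_zero) hu)
      exact exists_end_pi_pow_eq_algebraMap X hM.ne_zero (h j)
end
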